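/- Marstrand's projection theorem: Let C ⊆ ℝ² be a Borel set with Hausdorff dimension HD(C) > 1. Then, for Lebesgue-almost every λ ∈ ℝ, the set π_λ(C) ⊆ ℝ has positive one-dimensional Lebesgue outer measure, where π_λ(x,y) := x − λ·y. -/

import Mathlib

open MeasureTheory Set Filter Topology
open scoped ENNReal NNReal

theorem exists_cylinder_image_subset {X : Type*} [TopologicalSpace X] {f : (ℕ → ℕ) → X}
    (hf : Continuous f) (b : ℕ → ℕ) {U : Set X} (hU : IsOpen U)
    (hbU : f '' Set.pi univ (fun i => Iic (b i)) ⊆ U) :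
    ∃ k, f '' {x | ∀ i < k, x i ≤ b i} ⊆ U := by
  by_contra! h
  have h' : ∀ k, ∃ x : ℕ → ℕ, (∀ i < k, x i ≤ b i) ∧ f x ∉ U := by
    intro k
    obtain ⟨_, ⟨x, hx, rfl⟩, hxU⟩ := not_subset.1 (h k)
    exact ⟨x, hx, hxU⟩
  choose x hx hxU using h'
  have hK : IsCompact (Set.pi univ (fun i => Iic (b i))) :=
    isCompact_univ_pi fun i => (finite_Iic (b i)).isCompact
  obtain ⟨y, hy, φ, hφ, hlim⟩ := hK.tendsto_subseq (x := fun k i => min (x k i) (b i))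
    (fun k i _ => mem_Iic.2 (min_le_right _ _))
  have hlim' : Tendsto (fun k => x (φ k)) atTop (𝓝 y) := by
    rw [tendsto_pi_nhds] at hlim ⊢
    intro i
    refine (hlim i).congr' ?_
    filter_upwards [eventually_gt_atTop i] with k hk
    exact min_eq_left (hx _ _ (hk.trans_le (hφ.id_le k)))
  have : f y ∈ Uᶜ := hU.isClosed_compl.mem_of_tendsto ((hf.tendsto y).comp hlim')
    (Eventually.of_forall fun k => hxU (φ k))
  exact this (hbU ⟨y, hy, rfl⟩)

theorem MeasureTheory.AnalyticSet.exists_isCompact_le_measure {X : Type*} [TopologicalSpace X]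
    [MeasurableSpace X] {μ : Measure X} [μ.OuterRegular] {A : Set X}
    (hA : AnalyticSet A) {r : ℝ≥0∞} (hr : r < μ A) :
    ∃ K ⊆ A, IsCompact K ∧ r ≤ μ K := by
  rw [AnalyticSet] at hA
  rcases hA with rfl | ⟨f, hf, rfl⟩
  · simp at hr
  have step : ∀ (k : ℕ) (S : {S : Set (ℕ → ℕ) // r < μ (f '' S)}),
      ∃ n, r < μ (f '' (S.1 ∩ {x | x k ≤ n})) := by
    rintro k ⟨S, hS⟩
    have hmono : Monotone fun n => f '' (S ∩ {x | x k ≤ n}) := fun m n hmn =>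
      image_mono (inter_subset_inter_right _ fun x (hx : x k ≤ m) => hx.trans hmn)
    have hunion : ⋃ n, f '' (S ∩ {x | x k ≤ n}) = f '' S := by
      rw [← image_iUnion, ← inter_iUnion]
      congr 1
      exact inter_eq_left.2 fun x _ => mem_iUnion.2 ⟨x k, le_refl (x k)⟩
    rw [← hunion, hmono.measure_iUnion] at hS
    exact lt_iSup_iff.1 hS
  choose c hc using step
  let S : ℕ → {S : Set (ℕ → ℕ) // r < μ (f '' S)} := fun k =>
    Nat.rec ⟨univ, by rwa [image_univ]⟩ (fun k S => ⟨S.1 ∩ {x | x k ≤ c k S}, hc k S⟩) k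
  let b : ℕ → ℕ := fun k => c k (S k)
  have hS : ∀ k, (S k).1 = {x | ∀ i < k, x i ≤ b i} := by
    intro k
    induction k with
    | zero => simp [S]
    | succ k ih =>
      have : (S (k + 1)).1 = (S k).1 ∩ {x | x k ≤ b k} := rfl
      rw [this, ih]
      ext x
      simp only [mem_inter_iff, mem_ofPred_eq, Nat.forall_lt_succ_right]
  refine ⟨f '' Set.pi univ (fun i => Iic (b i)), image_subset_range _ _,
    (isCompact_univ_pi fun i => (finite_Iic (b i)).isCompact).image hf, ?_⟩
  rw [Set.measure_eq_iInf_isOpen]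
  refine le_iInf₂ fun U hU => le_iInf fun hUo => ?_
  obtain ⟨k, hk⟩ := exists_cylinder_image_subset hf b hUo hU
  rw [← hS] at hk
  exact (S k).2.le.trans (measure_mono hk)

theorem MeasureTheory.AnalyticSet.nullMeasurableSet {X : Type*} [TopologicalSpace X]
    [PolishSpace X] [MeasurableSpace X] [BorelSpace X] {A : Set X} (hA : AnalyticSet A)
    (μ : Measure X) [SFinite μ] : NullMeasurableSet A μ := by
  let _ := TopologicalSpace.upgradeIsCompletelyMetrizable X
  refine NullMeasurableSet.mono_ac (μ := μ.toFinite) ?_ (absolutelyContinuous_toFinite μ)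
  set ν := μ.toFinite
  rcases eq_or_ne (ν A) 0 with h0 | h0
  · exact NullMeasurableSet.of_null h0
  obtain ⟨u, -, hu, hlim⟩ := exists_seq_strictMono_tendsto' (pos_iff_ne_zero.2 h0)
  choose K hKA hK huK using fun n => hA.exists_isCompact_le_measure (μ := ν) (hu n).2
  have hm : MeasurableSet (⋃ n, K n) := .iUnion fun n => (hK n).measurableSet
  have hle : ν A ≤ ν (⋃ n, K n) :=
    le_of_tendsto' hlim fun n => (huK n).trans (measure_mono (subset_iUnion _ _))
  have := ae_eq_of_subset_of_measure_ge (iUnion_subset hKA) hle hm.nullMeasurableSet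
    (measure_ne_top _ _)
  exact hm.nullMeasurableSet.congr this

theorem lintegral_comp_add_mul {F : ℝ → ℝ≥0∞} (hF : Measurable F) (x : ℝ) {d : ℝ} (hd : d ≠ 0) :
    ∫⁻ l, F (x + l * d) = ENNReal.ofReal |d⁻¹| * ∫⁻ u, F u := by
  rw [← lintegral_add_left_eq_self F x, ← smul_eq_mul, ← lintegral_smul_measure,
    ← Real.map_volume_mul_right hd, lintegral_map (by fun_prop) (by fun_prop)]

theorem lintegral_mul_lintegral_comp_sub_mul {g H : ℝ × ℝ → ℝ≥0∞} (hg : Measurable g)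
    (hH : Measurable H) :
    ∫⁻ p, g p * ∫⁻ l, H (l, p.1 - l * p.2) =
      ∫⁻ q, H q * ∫⁻ y, g (q.2 + q.1 * y, y) := by
  calc ∫⁻ p, g p * ∫⁻ l, H (l, p.1 - l * p.2)
      = ∫⁻ p : ℝ × ℝ, ∫⁻ l, g p * H (l, p.1 - l * p.2) := by
        congr with p
        rw [lintegral_const_mul _ (by fun_prop)]
    _ = ∫⁻ l, ∫⁻ p : ℝ × ℝ, g p * H (l, p.1 - l * p.2) :=
        lintegral_lintegral_swap (by fun_prop)
    _ = ∫⁻ l, ∫⁻ y, ∫⁻ x, g (x, y) * H (l, x - l * y) := by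
        congr with l
        rw [Measure.volume_eq_prod, lintegral_prod_symm' _ (by fun_prop)]
    _ = ∫⁻ l, ∫⁻ y, ∫⁻ t, g (t + l * y, y) * H (l, t) := by
        congr with l
        congr with y
        rw [← lintegral_add_right_eq_self _ (l * y)]
        simp
    _ = ∫⁻ l, ∫⁻ t, ∫⁻ y, g (t + l * y, y) * H (l, t) := by
        congr with l
        exact lintegral_lintegral_swap (by fun_prop)
    _ = ∫⁻ l, ∫⁻ t, H (l, t) * ∫⁻ y, g (t + l * y, y) := by
        congr with l
        congr with t
        rw [lintegral_mul_const _ (by fun_prop), mul_comm]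
    _ = ∫⁻ q, H q * ∫⁻ y, g (q.2 + q.1 * y, y) := by
        rw [Measure.volume_eq_prod, lintegral_prod]
        exact (hH.mul (Measurable.lintegral_prod_right' (f := fun z : (ℝ × ℝ) × ℝ =>
          g (z.1.2 + z.1.1 * z.2, z.2)) (by fun_prop))).aemeasurable

theorem lintegral_le_of_kernel_bound {g : ℝ × ℝ → ℝ≥0∞} (hg : Measurable g) (hfin : ∫⁻ p, g p ≠ ∞)
    {J : Set ℝ} (hJ : MeasurableSet J) {S : Set (ℝ × ℝ)} (hS : MeasurableSet S)
    (hSJ : ∀ q ∈ S, q.1 ∈ J) {a C : ℝ≥0} (ha : a ≠ 0) (hC : C ≠ 0)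
    (hgS : ∀ p, g p ≠ 0 → a ≤ volume {l : ℝ | (l, p.1 - l * p.2) ∈ S})
    (hgC : ∀ p, g p ≠ 0 → ∫⁻ l in J, ∫⁻ y, g (p.1 + l * (y - p.2), y) ≤ C) :
    ∫⁻ p, g p ≤ C / a ^ 2 * volume S := by
  set T : ℝ × ℝ → ℝ≥0∞ := fun q => ∫⁻ y, g (q.2 + q.1 * y, y) with hT
  have hTm : Measurable T := Measurable.lintegral_prod_right' (f := fun z : (ℝ × ℝ) × ℝ =>
          g (z.1.2 + z.1.1 * z.2, z.2)) (by fun_prop)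
  set M := ∫⁻ p, g p with hM
  have hS' : ∀ p : ℝ × ℝ, MeasurableSet {l : ℝ | (l, p.1 - l * p.2) ∈ S} := fun p =>
    hS.preimage (by fun_prop)
  have h1 : a * M ≤ ∫⁻ q in S, T q := by
    have := lintegral_mul_lintegral_comp_sub_mul hg
      (H := S.indicator 1) (measurable_one.indicator hS)
    calc a * M = ∫⁻ p, g p * a := by rw [lintegral_mul_const _ hg, mul_comm]
      _ ≤ ∫⁻ p, g p * ∫⁻ l, S.indicator 1 (l, p.1 - l * p.2) := by
        refine lintegral_mono fun p => ?_
        rcases eq_or_ne (g p) 0 with h0 | h0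
        · simp [h0]
        · gcongr
          refine (hgS p h0).trans_eq ?_
          rw [← lintegral_indicator_one (hS' p)]
          rfl
      _ = ∫⁻ q in S, T q := by
        rw [this, ← lintegral_indicator hS]
        congr with q
        by_cases hq : q ∈ S <;> simp [hq, hT]
  have h2 : ∫⁻ q in S, T q ^ 2 ≤ C * M := by
    have := lintegral_mul_lintegral_comp_sub_mul hg
      (H := (Prod.fst ⁻¹' J).indicator T) (hTm.indicator (hJ.preimage measurable_fst))
    calc ∫⁻ q in S, T q ^ 2
        ≤ ∫⁻ q, (Prod.fst ⁻¹' J).indicator T q * ∫⁻ y, g (q.2 + q.1 * y, y) := by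
          rw [← lintegral_indicator hS]
          refine lintegral_mono fun q => ?_
          by_cases hq : q ∈ S
          · have : q ∈ Prod.fst ⁻¹' J := hSJ q hq
            simp [hq, this, sq, hT]
          · simp [hq]
      _ = ∫⁻ p, g p * ∫⁻ l, (Prod.fst ⁻¹' J).indicator T (l, p.1 - l * p.2) := this.symm
      _ ≤ ∫⁻ p, g p * C := by
        refine lintegral_mono fun p => ?_
        rcases eq_or_ne (g p) 0 with h0 | h0
        · simp [h0]
        · gcongr
          refine le_trans (le_of_eq ?_) (hgC p h0)
          rw [← lintegral_indicator hJ]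
          congr with l
          have : ∀ y, p.1 - l * p.2 + l * y = p.1 + l * (y - p.2) := fun y => by ring
          by_cases hl : l ∈ J <;> simp [hl, hT, this]
      _ = C * M := by rw [lintegral_mul_const _ hg, mul_comm]
  have h3 : a * M + a * M ≤ C / a * volume S + a * M := by
    have hpt : ∀ u : ℝ≥0∞, u + u ≤ C / a + a / C * u ^ 2 := by
      intro u
      rcases eq_or_ne u ∞ with rfl | hu
      · have : (a / C : ℝ≥0∞) ≠ 0 := by simp [ha]
        simp [ENNReal.mul_top this]
      lift u to ℝ≥0 using hu
      rw [← ENNReal.coe_div hC, ← ENNReal.coe_div ha]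
      norm_cast
      rw [← NNReal.coe_le_coe]
      push_cast
      have ha' : (0 : ℝ) < a := by positivity
      have hC' : (0 : ℝ) < C := by positivity
      have : (C / a + a / C * u ^ 2 : ℝ) - (u + u) = (C - a * u) ^ 2 / (a * C) := by
        field_simp; ring
      have h' : 0 ≤ ((C - a * u) ^ 2 / (a * C) : ℝ) := by positivity
      linarith
    calc a * M + a * M ≤ ∫⁻ q in S, (T q + T q) := by
          rw [lintegral_add_left hTm]; gcongr
      _ ≤ ∫⁻ q in S, (C / a + a / C * T q ^ 2) := lintegral_mono fun q => hpt _
      _ = C / a * volume S + a / C * ∫⁻ q in S, T q ^ 2 := by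
          rw [lintegral_add_left measurable_const, lintegral_const_mul _ (by fun_prop)]
          simp
      _ ≤ C / a * volume S + a / C * (C * M) := by gcongr
      _ = C / a * volume S + a * M := by
          rw [← mul_assoc, ENNReal.div_mul_cancel (by simpa) (by simp)]
  have h4 : a * M ≤ C / a * volume S :=
    (ENNReal.add_le_add_iff_right (ENNReal.mul_ne_top (by simp) hfin)).1 h3
  have ha0 : (a : ℝ≥0∞) ≠ 0 := by simpa
  calc M = (a : ℝ≥0∞)⁻¹ * (a * M) := by
        rw [← mul_assoc, ENNReal.inv_mul_cancel ha0 (by simp), one_mul]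
    _ ≤ (a : ℝ≥0∞)⁻¹ * (C / a * volume S) := by gcongr
    _ = C / a ^ 2 * volume S := by
        rw [← mul_assoc, sq, div_eq_mul_inv, div_eq_mul_inv,
          ENNReal.mul_inv (Or.inl ha0) (Or.inl (by simp))]
        ring

/-- The index `(k, i, j)` of the half-open dyadic square of side `2⁻ᵏ` that contains `p`. -/
noncomputable def dyadicIndex (k : ℕ) (p : ℝ × ℝ) : ℕ × ℤ × ℤ :=
  (k, ⌊2 ^ k * p.1⌋, ⌊2 ^ k * p.2⌋)

/-- The half-open dyadic square `[i 2⁻ᵏ, (i + 1) 2⁻ᵏ) × [j 2⁻ᵏ, (j + 1) 2⁻ᵏ)` with index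
`(k, i, j)`. -/
def dyadicSquare (Q : ℕ × ℤ × ℤ) : Set (ℝ × ℝ) := {p | dyadicIndex Q.1 p = Q}

theorem mem_dyadicSquare {Q : ℕ × ℤ × ℤ} {p : ℝ × ℝ} :
    p ∈ dyadicSquare Q ↔ dyadicIndex Q.1 p = Q := Iff.rfl

theorem mem_dyadicSquare_dyadicIndex (k : ℕ) (p : ℝ × ℝ) :
    p ∈ dyadicSquare (dyadicIndex k p) := rfl

theorem floor_two_pow_mul_eq_of_le {m k : ℕ} (hmk : m ≤ k) (x : ℝ) :
    ⌊2 ^ m * x⌋ = ⌊2 ^ k * x⌋ / (2 ^ (k - m) : ℕ) := by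
  rw [← Int.floor_div_natCast]
  congr 1
  obtain ⟨d, rfl⟩ := Nat.exists_eq_add_of_le hmk
  simp only [Nat.add_sub_cancel_left]
  push_cast
  rw [pow_add]
  field_simp

theorem dyadicIndex_eq_of_le {m k : ℕ} (hmk : m ≤ k) {p q : ℝ × ℝ}
    (h : dyadicIndex k p = dyadicIndex k q) : dyadicIndex m p = dyadicIndex m q := by
  simp only [dyadicIndex, Prod.mk.injEq, true_and] at h ⊢
  simp only [floor_two_pow_mul_eq_of_le hmk, h, and_self]

theorem dyadicSquare_eq_prod (Q : ℕ × ℤ × ℤ) :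
    dyadicSquare Q = Ico (Q.2.1 / 2 ^ Q.1 : ℝ) ((Q.2.1 + 1) / 2 ^ Q.1) ×ˢ
      Ico (Q.2.2 / 2 ^ Q.1 : ℝ) ((Q.2.2 + 1) / 2 ^ Q.1) := by
  obtain ⟨k, i, j⟩ := Q
  ext p
  simp only [dyadicSquare, dyadicIndex, mem_ofPred_eq, Prod.mk.injEq, true_and, mem_prod, mem_Ico,
    Int.floor_eq_iff]
  have hk : (0 : ℝ) < 2 ^ k := by positivity
  rw [div_le_iff₀' hk, lt_div_iff₀' hk, div_le_iff₀' hk, lt_div_iff₀' hk]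

theorem measurableSet_dyadicSquare (Q : ℕ × ℤ × ℤ) : MeasurableSet (dyadicSquare Q) := by
  rw [dyadicSquare_eq_prod]
  exact measurableSet_Ico.prod measurableSet_Ico

theorem dyadicSquare_nonempty (Q : ℕ × ℤ × ℤ) : (dyadicSquare Q).Nonempty := by
  rw [dyadicSquare_eq_prod]
  have hk : (0 : ℝ) < 2 ^ Q.1 := by positivity
  refine Nonempty.prod ?_ ?_ <;> rw [nonempty_Ico] <;> gcongr <;> linarith

theorem volume_dyadicSquare (Q : ℕ × ℤ × ℤ) :
    volume (dyadicSquare Q) = (((4 : ℝ≥0) ^ Q.1)⁻¹ : ℝ≥0) := by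
  rw [dyadicSquare_eq_prod, Measure.volume_eq_prod, Measure.prod_prod, Real.volume_Ico,
    Real.volume_Ico, ← ENNReal.ofReal_mul (by rw [sub_nonneg]; gcongr; linarith),
    ENNReal.ofReal, ENNReal.coe_inj, ← NNReal.coe_inj, Real.coe_toNNReal]
  · push_cast
    rw [show (4 : ℝ) = 2 * 2 by norm_num, mul_pow]
    field_simp
    ring
  · apply mul_nonneg <;> · rw [sub_nonneg]; gcongr; linarith

theorem ediam_dyadicSquare_le (Q : ℕ × ℤ × ℤ) :
    Metric.ediam (dyadicSquare Q) ≤ (((2 : ℝ≥0) ^ Q.1)⁻¹ : ℝ≥0) := by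
  refine Metric.ediam_le fun p hp q hq => ?_
  rw [edist_nndist, ENNReal.coe_le_coe, ← NNReal.coe_le_coe, coe_nndist]
  rw [dyadicSquare_eq_prod, mem_prod, mem_Ico, mem_Ico, add_div, add_div] at hp hq
  rw [Prod.dist_eq, Real.dist_eq, Real.dist_eq]
  push_cast
  rw [← one_div]
  refine max_le ?_ ?_ <;> rw [abs_le] <;> constructor <;>
    linarith [hp.1.1, hp.1.2, hp.2.1, hp.2.2, hq.1.1, hq.1.2, hq.2.1, hq.2.2]

theorem setLIntegral_box_le {g : ℝ × ℝ → ℝ≥0∞} {β : ℝ≥0}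
    (hgβ : ∀ Q, ∫⁻ p in dyadicSquare Q, g p ≤ (β ^ Q.1 : ℝ≥0)) (R k : ℕ) (p : ℝ × ℝ) :
    ∫⁻ q in {q | |q.1 - p.1| ≤ R / 2 ^ k ∧ |q.2 - p.2| ≤ 1 / 2 ^ k}, g q ≤
      ((2 * R + 1) * 3 * β ^ k : ℝ≥0) := by
  set i := ⌊2 ^ k * p.1⌋ with hi
  set j := ⌊2 ^ k * p.2⌋ with hj
  set I : Finset (ℤ × ℤ) := Finset.Icc (i - R) (i + R) ×ˢ Finset.Icc (j - 1) (j + 1) with hI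
  have hk : (0 : ℝ) < 2 ^ k := by positivity
  have hfloor : ∀ (x y : ℝ) (n : ℕ), |y - x| ≤ n / 2 ^ k →
      ⌊2 ^ k * x⌋ - n ≤ ⌊2 ^ k * y⌋ ∧ ⌊2 ^ k * y⌋ ≤ ⌊2 ^ k * x⌋ + n := by
    intro x y n h
    rw [abs_le, ← neg_div, div_le_iff₀' hk, le_div_iff₀' hk] at h
    rw [← Int.floor_sub_natCast, ← Int.floor_add_natCast]
    constructor <;> apply Int.floor_le_floor <;> linarith
  have hsub : {q : ℝ × ℝ | |q.1 - p.1| ≤ R / 2 ^ k ∧ |q.2 - p.2| ≤ 1 / 2 ^ k} ⊆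
      ⋃ z : I, dyadicSquare (k, z) := by
    rintro q ⟨h1, h2⟩
    refine mem_iUnion.2 ⟨⟨(⌊2 ^ k * q.1⌋, ⌊2 ^ k * q.2⌋), ?_⟩, rfl⟩
    have h1' := hfloor _ _ _ h1
    have h2' := hfloor _ _ 1 (by simpa using h2)
    simp only [hI, Finset.mem_product, Finset.mem_Icc]
    exact ⟨h1', by simpa using h2'⟩
  calc _ ≤ ∫⁻ q in ⋃ z : I, dyadicSquare (k, z), g q := lintegral_mono_set hsub
    _ ≤ ∑ z ∈ I, ∫⁻ q in dyadicSquare (k, z), g q := by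
      refine (lintegral_iUnion_le _ _).trans_eq ?_
      rw [tsum_fintype]
      exact Finset.sum_coe_sort I fun z => ∫⁻ q in dyadicSquare (k, z), g q
    _ ≤ ∑ z ∈ I, ((β ^ k : ℝ≥0) : ℝ≥0∞) := Finset.sum_le_sum fun z _ => hgβ (k, z)
    _ = ((2 * R + 1) * 3 * β ^ k : ℝ≥0) := by
      have hcard : I.card = (2 * R + 1) * 3 := by
        simp only [hI, Finset.card_product, Int.card_Icc]
        congr 1 <;> omega
      rw [Finset.sum_const, hcard, nsmul_eq_mul]
      push_cast
      ring

theorem exists_inv_abs_le_two_pow {d : ℝ} (hd : d ≠ 0) (hd1 : |d| ≤ 1) :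
    ∃ k : ℕ, |d| ≤ 1 / 2 ^ k ∧ |d⁻¹| ≤ 2 ^ (k + 1) := by
  obtain ⟨k, h1, h2⟩ := exists_nat_pow_near_of_lt_one (abs_pos.2 hd) hd1
    (show (0 : ℝ) < 1 / 2 by norm_num) (by norm_num)
  refine ⟨k, by simpa using h2, ?_⟩
  rw [abs_inv, inv_le_comm₀ (abs_pos.2 hd) (by positivity)]
  simpa using h1.le

theorem exists_kernel_bound (R : ℕ) {β : ℝ≥0} (hβ : 2 * β < 1) :
    ∃ C : ℝ≥0, C ≠ 0 ∧ ∀ g : ℝ × ℝ → ℝ≥0∞, Measurable g →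
      (∀ Q, ∫⁻ p in dyadicSquare Q, g p ≤ (β ^ Q.1 : ℝ≥0)) → ∀ p : ℝ × ℝ,
      (∀ q, g q ≠ 0 → |q.2 - p.2| ≤ 1) →
      ∫⁻ l in Icc (-R : ℝ) R, ∫⁻ y, g (p.1 + l * (y - p.2), y) ≤ C := by
  have hsum : Summable fun k : ℕ => (2 ^ (k + 1) * ((2 * R + 1) * 3 * β ^ k) : ℝ≥0) := by
    have := (NNReal.summable_geometric hβ).mul_left (2 * ((2 * R + 1) * 3) : ℝ≥0)
    refine this.congr fun k => ?_
    rw [mul_pow, pow_succ]; ring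
  refine ⟨∑' k : ℕ, (2 ^ (k + 1) * ((2 * R + 1) * 3 * β ^ k) : ℝ≥0), ?_, ?_⟩
  · refine (NNReal.tsum_pos hsum 0 ?_).ne'
    simp only [pow_zero, mul_one]
    positivity
  intro g hg hgβ p hp
  set B : ℕ → Set (ℝ × ℝ) := fun k => {q | |q.1 - p.1| ≤ R / 2 ^ k ∧ |q.2 - p.2| ≤ 1 / 2 ^ k}
  have hB : ∀ k, MeasurableSet (B k) := fun k => by
    change MeasurableSet ({q : ℝ × ℝ | |q.1 - p.1| ≤ R / 2 ^ k} ∩ {q | |q.2 - p.2| ≤ 1 / 2 ^ k})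
    exact (measurableSet_le (by fun_prop) (by fun_prop)).inter
      (measurableSet_le (by fun_prop) (by fun_prop))
  have hgB : ∀ k, Measurable ((B k).indicator g) := fun k => hg.indicator (hB k)
  have key : ∀ y ≠ p.2, ∫⁻ l in Icc (-R : ℝ) R, g (p.1 + l * (y - p.2), y) ≤
      ∑' k : ℕ, 2 ^ (k + 1) * ∫⁻ x, (B k).indicator g (x, y) := by
    intro y hy
    have hd : y - p.2 ≠ 0 := sub_ne_zero.2 hy
    by_cases hd1 : |y - p.2| ≤ 1
    · obtain ⟨k, hk1, hk2⟩ := exists_inv_abs_le_two_pow hd hd1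
      refine le_trans ?_ (ENNReal.le_tsum k)
      calc ∫⁻ l in Icc (-R : ℝ) R, g (p.1 + l * (y - p.2), y)
          ≤ ∫⁻ l, (B k).indicator g (p.1 + l * (y - p.2), y) := by
            rw [← lintegral_indicator measurableSet_Icc]
            refine lintegral_mono fun l => ?_
            refine indicator_apply_le' (fun hl => ?_) fun _ => zero_le
            rw [indicator_of_mem]
            refine ⟨?_, hk1⟩
            rw [add_sub_cancel_left, abs_mul, div_eq_mul_one_div]
            gcongr
            exact abs_le.2 hl
        _ = ENNReal.ofReal |(y - p.2)⁻¹| * ∫⁻ x, (B k).indicator g (x, y) :=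
            lintegral_comp_add_mul (F := fun x => (B k).indicator g (x, y))
              ((hgB k).comp (by fun_prop)) _ hd
        _ ≤ _ := by
            gcongr
            refine (ENNReal.ofReal_le_ofReal hk2).trans_eq ?_
            rw [ENNReal.ofReal_pow (by norm_num), ENNReal.ofReal_ofNat]
    · have : ∀ l, g (p.1 + l * (y - p.2), y) = 0 := fun l => by
        by_contra h
        exact hd1 (hp _ h)
      simp [this]
  calc ∫⁻ l in Icc (-R : ℝ) R, ∫⁻ y, g (p.1 + l * (y - p.2), y)
      = ∫⁻ y, ∫⁻ l in Icc (-R : ℝ) R, g (p.1 + l * (y - p.2), y) :=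
        lintegral_lintegral_swap (by fun_prop)
    _ ≤ ∫⁻ y, ∑' k : ℕ, 2 ^ (k + 1) * ∫⁻ x, (B k).indicator g (x, y) := by
        refine lintegral_mono_ae ?_
        filter_upwards [Measure.ae_ne volume p.2] with y hy using key y hy
    _ = ∑' k : ℕ, 2 ^ (k + 1) * ∫⁻ q in B k, g q := by
        rw [lintegral_tsum fun k => ((hgB k).lintegral_prod_left').const_mul _ |>.aemeasurable]
        congr with k
        rw [lintegral_const_mul _ (hgB k).lintegral_prod_left', ← lintegral_indicator (hB k),
          Measure.volume_eq_prod, lintegral_prod_symm' _ (hgB k)]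
    _ ≤ ∑' k : ℕ, (2 : ℝ≥0∞) ^ (k + 1) * (((2 * R + 1) * 3 * β ^ k : ℝ≥0) : ℝ≥0∞) := by
        refine ENNReal.tsum_le_tsum fun k => ?_
        gcongr
        exact setLIntegral_box_le hgβ R k p
    _ = _ := by
        rw [ENNReal.coe_tsum hsum]
        push_cast
        rfl

theorem exists_greedy_weights {ι : Type*} [DecidableEq ι] (A : ℕ → Finset ι) (b : ι → ℝ≥0) :
    ∃ w : ℕ → ℝ≥0, (∀ n, A n = ∅ → w n = 0) ∧
      (∀ P N, ∑ i ∈ Finset.range N, (if P ∈ A i then w i else 0) ≤ b P) ∧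
      ∀ n, (A n).Nonempty → ∃ P ∈ A n,
        ∑ i ∈ Finset.range (n + 1), (if P ∈ A i then w i else 0) = b P := by
  classical
  let v : ℕ → (ι → ℝ≥0) → ℝ≥0 := fun n L =>
    if h : (A n).Nonempty then (A n).inf' h fun P => b P - L P else 0
  let L : ℕ → ι → ℝ≥0 := fun n =>
    Nat.rec 0 (fun n L P => L P + if P ∈ A n then v n L else 0) n
  have hLsum : ∀ N P, L N P = ∑ i ∈ Finset.range N, if P ∈ A i then v i (L i) else 0 := by
    intro N P
    induction N with
    | zero => rfl
    | succ N ih => rw [Finset.sum_range_succ, ← ih]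
  have hLb : ∀ N P, L N P ≤ b P := by
    intro N P
    induction N with
    | zero => exact zero_le
    | succ N ih =>
      change L N P + (if P ∈ A N then v N (L N) else 0) ≤ b P
      split_ifs with hP
      · have hne : (A N).Nonempty := ⟨P, hP⟩
        have : v N (L N) ≤ b P - L N P := by
          simp only [v, hne, dif_pos]
          exact Finset.inf'_le (fun P => b P - L N P) hP
        exact (add_le_add_right this _).trans_eq (add_tsub_cancel_of_le ih)
      · simpa using ih
  refine ⟨fun n => v n (L n), fun n hn => by simp [v, hn], fun P N => ?_, fun n hn => ?_⟩
  · rw [← hLsum]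
    exact hLb N P
  · obtain ⟨P, hP, hmin⟩ := Finset.exists_mem_eq_inf' hn fun P => b P - L n P
    refine ⟨P, hP, ?_⟩
    rw [Finset.sum_range_succ, ← hLsum, if_pos hP]
    simp only [v, hn, dif_pos]
    rw [hmin, add_tsub_cancel_of_le (hLb n P)]

theorem dyadicSquare_subset_of_mem {P Q : ℕ × ℤ × ℤ} (h : P.1 ≤ Q.1) {p : ℝ × ℝ}
    (hP : p ∈ dyadicSquare P) (hQ : p ∈ dyadicSquare Q) : dyadicSquare Q ⊆ dyadicSquare P :=
  fun _ hq => (dyadicIndex_eq_of_le h (hq.trans hQ.symm)).trans hP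

/-- The indices in `T` of dyadic squares not contained in a larger square with index in `T`. -/
def maximalSquares (T : Set (ℕ × ℤ × ℤ)) : Set (ℕ × ℤ × ℤ) :=
  {Q ∈ T | ∀ p ∈ dyadicSquare Q, ∀ m < Q.1, dyadicIndex m p ∉ T}

theorem exists_mem_maximalSquares {T : Set (ℕ × ℤ × ℤ)} {P : ℕ × ℤ × ℤ} (hP : P ∈ T) {p : ℝ × ℝ}
    (hp : p ∈ dyadicSquare P) : ∃ Q ∈ maximalSquares T, p ∈ dyadicSquare Q := by
  classical
  have hex : ∃ k, dyadicIndex k p ∈ T := ⟨P.1, by rwa [mem_dyadicSquare.1 hp]⟩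
  refine ⟨dyadicIndex (Nat.find hex) p, ⟨Nat.find_spec hex, fun _ hq m hm => ?_⟩,
    mem_dyadicSquare_dyadicIndex _ _⟩
  rw [dyadicIndex_eq_of_le hm.le (mem_dyadicSquare.1 hq)]
  exact Nat.find_min hex hm

theorem eq_of_mem_maximalSquares {T : Set (ℕ × ℤ × ℤ)} {P Q : ℕ × ℤ × ℤ}
    (hP : P ∈ maximalSquares T) (hQ : Q ∈ maximalSquares T) {p : ℝ × ℝ}
    (hpP : p ∈ dyadicSquare P) (hpQ : p ∈ dyadicSquare Q) : P = Q := by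
  rcases lt_trichotomy P.1 Q.1 with h | h | h
  · exact absurd (by rw [mem_dyadicSquare.1 hpP]; exact hP.1) (hQ.2 p hpQ _ h)
  · rw [← mem_dyadicSquare.1 hpP, ← mem_dyadicSquare.1 hpQ, h]
  · exact absurd (by rw [mem_dyadicSquare.1 hpQ]; exact hQ.1) (hP.2 p hpP _ h)

/-- The indices of the dyadic squares of side at most `1` containing the square with index `Q`. -/
noncomputable def dyadicAncestors (Q : ℕ × ℤ × ℤ) : Finset (ℕ × ℤ × ℤ) :=
  (Finset.range (Q.1 + 1)).image fun m => dyadicIndex m (dyadicSquare_nonempty Q).some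

theorem mem_dyadicAncestors {P Q : ℕ × ℤ × ℤ} :
    P ∈ dyadicAncestors Q ↔ P.1 ≤ Q.1 ∧ dyadicSquare Q ⊆ dyadicSquare P := by
  have hmem := (dyadicSquare_nonempty Q).some_mem
  simp only [dyadicAncestors, Finset.mem_image, Finset.mem_range, Nat.lt_succ_iff]
  constructor
  · rintro ⟨m, hm, rfl⟩
    exact ⟨hm, dyadicSquare_subset_of_mem hm (mem_dyadicSquare_dyadicIndex _ _) hmem⟩
  · rintro ⟨h, hsub⟩
    exact ⟨P.1, h, hsub hmem⟩

theorem exists_dyadicSquare_subset {G : Set (ℝ × ℝ)} (hG : IsOpen G) {p : ℝ × ℝ} (hp : p ∈ G) :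
    ∃ k, dyadicSquare (dyadicIndex k p) ⊆ G := by
  obtain ⟨ε, hε, hball⟩ := Metric.isOpen_iff.1 hG p hp
  obtain ⟨k, hk⟩ := exists_pow_lt_of_lt_one hε (show (1 / 2 : ℝ) < 1 by norm_num)
  refine ⟨k, fun q hq => hball ?_⟩
  have h1 := (Metric.edist_le_ediam_of_mem hq (mem_dyadicSquare_dyadicIndex k p)).trans
    (ediam_dyadicSquare_le _)
  rw [edist_nndist, ENNReal.coe_le_coe, ← NNReal.coe_le_coe, coe_nndist] at h1
  refine h1.trans_lt ?_
  simpa [dyadicIndex] using hk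

/-- The weight `w i`, spread uniformly over the square with index `e i`, summed over `i < N`. -/
noncomputable def dyadicDensity (e : ℕ → ℕ × ℤ × ℤ) (w : ℕ → ℝ≥0) (N : ℕ) (p : ℝ × ℝ) : ℝ≥0∞ :=
  ∑ i ∈ Finset.range N, (dyadicSquare (e i)).indicator (fun _ => (w i * 4 ^ (e i).1 : ℝ≥0∞)) p

theorem measurable_dyadicDensity (e : ℕ → ℕ × ℤ × ℤ) (w : ℕ → ℝ≥0) (N : ℕ) :
    Measurable (dyadicDensity e w N) :=
  Finset.measurable_fun_sum _ fun i _ =>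
    measurable_const.indicator (measurableSet_dyadicSquare (e i))

theorem setLIntegral_dyadicDensity (e : ℕ → ℕ × ℤ × ℤ) (w : ℕ → ℝ≥0) (N : ℕ) (S : Set (ℝ × ℝ)) :
    ∫⁻ p in S, dyadicDensity e w N p =
      ∑ i ∈ Finset.range N, w i * 4 ^ (e i).1 * volume (dyadicSquare (e i) ∩ S) := by
  simp only [dyadicDensity]
  rw [lintegral_finsetSum _ fun i _ =>
    measurable_const.indicator (measurableSet_dyadicSquare (e i))]
  refine Finset.sum_congr rfl fun i _ => ?_
  rw [lintegral_indicator_const (measurableSet_dyadicSquare _),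
    Measure.restrict_apply (measurableSet_dyadicSquare _)]

theorem mul_four_pow_mul_volume_dyadicSquare (w : ℝ≥0∞) (Q : ℕ × ℤ × ℤ) :
    w * 4 ^ Q.1 * volume (dyadicSquare Q) = w := by
  rw [volume_dyadicSquare, mul_assoc, ENNReal.coe_inv (by positivity)]
  push_cast
  rw [ENNReal.mul_inv_cancel (by positivity) (by finiteness), mul_one]

theorem setLIntegral_dyadicDensity_le {T : Set (ℕ × ℤ × ℤ)} {e : ℕ → ℕ × ℤ × ℤ}
    (he : Function.Injective e) {w : ℕ → ℝ≥0} (hwT : ∀ i, e i ∉ maximalSquares T → w i = 0)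
    {β : ℝ≥0} (hβ : 1 ≤ 4 * β) (hwe : ∀ i, w i ≤ β ^ (e i).1) (N : ℕ) (P : ℕ × ℤ × ℤ)
    (hP : ∑ i ∈ Finset.range N, (if P ∈ dyadicAncestors (e i) then w i else 0) ≤ β ^ P.1) :
    ∫⁻ p in dyadicSquare P, dyadicDensity e w N p ≤ (β ^ P.1 : ℝ≥0) := by
  rw [setLIntegral_dyadicDensity]
  by_cases hbig : ∃ i, e i ∈ maximalSquares T ∧ (e i).1 < P.1 ∧
      (dyadicSquare (e i) ∩ dyadicSquare P).Nonempty
  · obtain ⟨i, hiT, hi, q, hqi, hqP⟩ := hbig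
    have hsub := dyadicSquare_subset_of_mem hi.le hqi hqP
    have hzero : ∀ j, j ≠ i →
        (w j * 4 ^ (e j).1 * volume (dyadicSquare (e j) ∩ dyadicSquare P) : ℝ≥0∞) = 0 := by
      intro j hj
      by_cases hjT : e j ∈ maximalSquares T
      · have : dyadicSquare (e j) ∩ dyadicSquare P = ∅ := by
          by_contra hne
          obtain ⟨r, hrj, hrP⟩ := nonempty_iff_ne_empty.2 hne
          exact hj (he (eq_of_mem_maximalSquares hjT hiT hrj (hsub hrP)))
        simp [this]
      · simp [hwT j hjT]
    calc _ ≤ (w i * 4 ^ (e i).1 * volume (dyadicSquare (e i) ∩ dyadicSquare P) : ℝ≥0∞) := by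
          exact (Finset.sum_le_sum_of_subset (Finset.subset_insert i _)).trans_eq
            (Finset.sum_eq_single_of_mem i (Finset.mem_insert_self _ _) fun j _ => hzero j)
      _ ≤ (β ^ P.1 : ℝ≥0) := by
        rw [inter_eq_right.2 hsub, volume_dyadicSquare]
        norm_cast
        push_cast
        rw [← div_eq_mul_inv, div_le_iff₀ (by positivity)]
        calc w i * 4 ^ (e i).1 ≤ β ^ (e i).1 * 4 ^ (e i).1 := by gcongr; exact hwe i
          _ = (4 * β) ^ (e i).1 := by rw [mul_pow, mul_comm]
          _ ≤ (4 * β) ^ P.1 := pow_le_pow_right₀ hβ hi.le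
          _ = β ^ P.1 * 4 ^ P.1 := by rw [mul_pow, mul_comm]
  · refine le_trans ?_ (ENNReal.coe_le_coe.2 hP)
    rw [ENNReal.ofNNReal_finsetSum]
    refine Finset.sum_le_sum fun i _ => ?_
    by_cases hiT : e i ∈ maximalSquares T
    · rcases eq_empty_or_nonempty (dyadicSquare (e i) ∩ dyadicSquare P) with h | h
      · simp [h]
      · have hle : P.1 ≤ (e i).1 := by
          by_contra! hlt
          exact hbig ⟨i, hiT, hlt, h⟩
        obtain ⟨q, hqi, hqP⟩ := h
        rw [if_pos (mem_dyadicAncestors.2 ⟨hle, dyadicSquare_subset_of_mem hle hqP hqi⟩)]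
        calc _ ≤ (w i * 4 ^ (e i).1 * volume (dyadicSquare (e i)) : ℝ≥0∞) := by
              gcongr
              exact inter_subset_left
          _ = w i := mul_four_pow_mul_volume_dyadicSquare _ _
    · simp [hwT i hiT]

/-- Existence of a good dyadic cover by duality: if every density supported in `G ∩ D`, with `D` a
unit dyadic square, that gives every dyadic square of side `2⁻ᵏ` mass at most `βᵏ` has total mass
at most `η`, then `G ∩ D` is covered by dyadic squares for which the sum of `βᵏ` is at most `η`. -/
theorem exists_dyadic_cover_tsum_le {G : Set (ℝ × ℝ)} (hG : IsOpen G) (z : ℤ × ℤ)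
    {β : ℝ≥0} (hβ : 1 ≤ 4 * β) {η : ℝ≥0∞}
    (hη : ∀ g : ℝ × ℝ → ℝ≥0∞, Measurable g →
      (∀ Q, ∫⁻ p in dyadicSquare Q, g p ≤ (β ^ Q.1 : ℝ≥0)) →
      (∀ p, g p ≠ 0 → p ∈ G ∩ dyadicSquare (0, z)) → ∫⁻ p, g p ≤ η) :
    ∃ V : Set (ℕ × ℤ × ℤ), G ∩ dyadicSquare (0, z) ⊆ ⋃ Q : V, dyadicSquare Q ∧
      ∑' Q : V, ((β ^ Q.1.1 : ℝ≥0) : ℝ≥0∞) ≤ η := by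
  classical
  set T : Set (ℕ × ℤ × ℤ) := {Q | dyadicSquare Q ⊆ G ∩ dyadicSquare (0, z)} with hT
  let e : ℕ ≃ ℕ × ℤ × ℤ := (Denumerable.eqv _).symm
  let A : ℕ → Finset (ℕ × ℤ × ℤ) := fun n =>
    if e n ∈ maximalSquares T then dyadicAncestors (e n) else ∅
  obtain ⟨w, hw0, hwb, hwsat⟩ := exists_greedy_weights A fun P => β ^ P.1
  have hwT : ∀ i, e i ∉ maximalSquares T → w i = 0 := fun i hi => hw0 i (by simp [A, hi])
  have hself : ∀ i, e i ∈ dyadicAncestors (e i) := fun i =>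
    mem_dyadicAncestors.2 ⟨le_rfl, Subset.rfl⟩
  have hA : ∀ P i, (if P ∈ A i then w i else 0) =
      if P ∈ dyadicAncestors (e i) then w i else 0 := by
    intro P i
    by_cases hi : e i ∈ maximalSquares T
    · simp [A, hi]
    · simp [hwT i hi]
  simp only [hA] at hwb hwsat
  have hwe : ∀ i, w i ≤ β ^ (e i).1 := by
    intro i
    refine le_trans ?_ (hwb (e i) (i + 1))
    refine le_trans ?_ (Finset.single_le_sum (fun _ _ => zero_le) (Finset.self_mem_range_succ i))
    rw [if_pos (hself i)]
  have htotal : ∀ N, ((∑ i ∈ Finset.range N, w i : ℝ≥0) : ℝ≥0∞) ≤ η := by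
    intro N
    refine le_trans (le_of_eq ?_) (hη (dyadicDensity e w N) (measurable_dyadicDensity _ _ _)
      (fun P => setLIntegral_dyadicDensity_le e.injective hwT hβ hwe N P (hwb P N)) ?_)
    · rw [← setLIntegral_univ, setLIntegral_dyadicDensity, ENNReal.ofNNReal_finsetSum]
      refine Finset.sum_congr rfl fun i _ => ?_
      rw [inter_univ, mul_four_pow_mul_volume_dyadicSquare]
    · intro p hp
      obtain ⟨i, -, hi⟩ := Finset.exists_ne_zero_of_sum_ne_zero hp
      have hpi : p ∈ dyadicSquare (e i) := mem_of_indicator_ne_zero hi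
      have hiT : e i ∈ maximalSquares T := by
        by_contra h
        simp [hwT i h] at hi
      exact hiT.1 hpi
  set W : Set (ℕ × ℤ × ℤ) := {P | ∃ N, ∑ i ∈ Finset.range N,
    (if P ∈ dyadicAncestors (e i) then w i else 0) = β ^ P.1}
  refine ⟨maximalSquares W, fun p hp => ?_, ?_⟩
  · obtain ⟨k, hk⟩ := exists_dyadicSquare_subset hG hp.1
    have hkT : dyadicIndex k p ∈ T := subset_inter hk
      (dyadicSquare_subset_of_mem (zero_le) hp.2 (mem_dyadicSquare_dyadicIndex k p))
    obtain ⟨Q, hQ, hpQ⟩ := exists_mem_maximalSquares hkT (mem_dyadicSquare_dyadicIndex k p)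
    obtain ⟨n, rfl⟩ := e.surjective Q
    obtain ⟨P, hPn, hPsat⟩ := hwsat n ⟨e n, by simp [A, hQ, hself n]⟩
    have hPn' : P ∈ dyadicAncestors (e n) := by simpa [A, hQ] using hPn
    obtain ⟨Q', hQ', hpQ'⟩ := exists_mem_maximalSquares (T := W) ⟨n + 1, hPsat⟩
      ((mem_dyadicAncestors.1 hPn').2 hpQ)
    exact mem_iUnion.2 ⟨⟨Q', hQ'⟩, hpQ'⟩
  · rw [ENNReal.tsum_eq_iSup_sum]
    refine iSup_le fun F => ?_
    choose N hN using fun P : maximalSquares W => P.2.1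
    refine le_trans ?_ (htotal (F.sup N))
    rw [← ENNReal.ofNNReal_finsetSum, ENNReal.coe_le_coe]
    calc ∑ P ∈ F, β ^ P.1.1
        ≤ ∑ P ∈ F, ∑ i ∈ Finset.range (F.sup N),
            (if P.1 ∈ dyadicAncestors (e i) then w i else 0) := by
          refine Finset.sum_le_sum fun P hP => ?_
          rw [← hN P]
          exact Finset.sum_le_sum_of_subset (Finset.range_mono (Finset.le_sup hP))
      _ = ∑ i ∈ Finset.range (F.sup N), ∑ P ∈ F,
            (if P.1 ∈ dyadicAncestors (e i) then w i else 0) := Finset.sum_comm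
      _ ≤ ∑ i ∈ Finset.range (F.sup N), w i := by
          refine Finset.sum_le_sum fun i _ => ?_
          rw [← Finset.sum_filter, Finset.sum_const]
          refine (nsmul_le_nsmul_left zero_le (Finset.card_le_one.2 ?_)).trans_eq (one_nsmul _)
          intro P hP Q hQ
          rw [Finset.mem_filter, mem_dyadicAncestors] at hP hQ
          obtain ⟨q, hq⟩ := dyadicSquare_nonempty (e i)
          exact Subtype.ext (eq_of_mem_maximalSquares P.2 Q.2 (hP.2.2 hq) (hQ.2.2 hq))

theorem isOpen_setOf_lt_volume_lines {E : Set (ℝ × ℝ)} (hE : IsOpen E) {J : Set ℝ}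
    (hJ : MeasurableSet J) (a : ℝ≥0∞) :
    IsOpen {p : ℝ × ℝ | a < volume {l : ℝ | (l, p.1 - l * p.2) ∈ E ∩ J ×ˢ univ}} := by
  rw [isOpen_iff_mem_nhds]
  intro p hp
  have hm : MeasurableSet {l : ℝ | (l, p.1 - l * p.2) ∈ E ∩ J ×ˢ univ} :=
    (hE.measurableSet.inter (hJ.prod .univ)).preimage (by fun_prop)
  obtain ⟨K, hKsub, hK, haK⟩ := hm.exists_lt_isCompact hp
  have hev : ∀ᶠ q : ℝ × ℝ in 𝓝 p, ∀ l ∈ K, (l, q.1 - l * q.2) ∈ E := by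
    refine hK.eventually_forall_of_forall_eventually fun l hl => ?_
    have hcont : Continuous fun z : (ℝ × ℝ) × ℝ => (z.2, z.1.1 - z.2 * z.1.2) := by fun_prop
    exact hcont.continuousAt.eventually_mem (hE.mem_nhds (hKsub hl).1)
  filter_upwards [hev] with q hq
  exact haK.trans_le (measure_mono fun l hl => ⟨hq l hl, (hKsub hl).2⟩)

theorem hausdorffMeasure_inter_eq_zero {C : Set (ℝ × ℝ)} {J : Set ℝ} (hJ : MeasurableSet J)
    (hJ0 : volume J ≠ 0) {R : ℕ} (hJR : J ⊆ Icc (-R : ℝ) R) {B : Set (ℝ × ℝ)}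
    (hB : volume B = 0) (hCB : ∀ p ∈ C, ∀ l ∈ J, (l, p.1 - l * p.2) ∈ B) {s : ℝ≥0} (hs1 : 1 < s)
    (hs2 : s < 2) (z : ℤ × ℤ) : μH[s] (C ∩ dyadicSquare (0, z)) = 0 := by
  set β : ℝ≥0 := 2⁻¹ ^ (s : ℝ) with hβ
  have hβ2 : 2 * β < 1 := by
    have : β < 2⁻¹ := by
      simpa using NNReal.rpow_lt_rpow_of_exponent_gt (x := 2⁻¹) (by norm_num)
        (NNReal.inv_lt_one_iff (by norm_num) |>.2 (by norm_num)) (NNReal.coe_lt_coe.2 hs1)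
    calc 2 * β < 2 * 2⁻¹ := by gcongr
      _ = 1 := by norm_num
  have hβ4 : 1 ≤ 4 * β := by
    have : (2⁻¹ : ℝ≥0) ^ (2 : ℝ) ≤ β :=
      NNReal.rpow_le_rpow_of_exponent_ge (by norm_num) (inv_le_one_of_one_le₀ (by norm_num))
        (by exact_mod_cast hs2.le)
    calc (1 : ℝ≥0) = 4 * 2⁻¹ ^ (2 : ℝ) := by
          rw [NNReal.rpow_ofNat, inv_pow]; norm_num
      _ ≤ 4 * β := by gcongr
  obtain ⟨a, ha0, haJ⟩ := ENNReal.lt_iff_exists_nnreal_btwn.1 (pos_iff_ne_zero.2 hJ0)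
  have ha : a ≠ 0 := by simpa using ha0.ne'
  obtain ⟨c, hc, hkernel⟩ := exists_kernel_bound R hβ2
  have hcover : ∀ n : ℕ, ∃ V : Set (ℕ × ℤ × ℤ), C ∩ dyadicSquare (0, z) ⊆ ⋃ Q : V, dyadicSquare Q ∧
      ∑' Q : V, ((β ^ Q.1.1 : ℝ≥0) : ℝ≥0∞) ≤ (n : ℝ≥0∞)⁻¹ := by
    intro n
    set K : ℝ≥0∞ := c / a ^ 2 with hK
    have hKtop : K ≠ ∞ := ENNReal.div_ne_top (by simp) (by simpa)
    have hK0 : K ≠ 0 := by simp [hK, hc]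
    obtain ⟨E, hBE, hE, hEvol⟩ := B.exists_isOpen_lt_of_lt (μ := volume) (K⁻¹ * (n : ℝ≥0∞)⁻¹)
      (by rw [hB, pos_iff_ne_zero]; simp [hKtop])
    have hS : MeasurableSet (E ∩ J ×ˢ univ) := hE.measurableSet.inter (hJ.prod .univ)
    obtain ⟨V, hV, hVsum⟩ := exists_dyadic_cover_tsum_le
      (isOpen_setOf_lt_volume_lines hE hJ a) z hβ4 (η := (n : ℝ≥0∞)⁻¹) fun g hg hgβ hgsupp => by
      have hfin : ∫⁻ p, g p ≠ ∞ := by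
        rw [← setLIntegral_eq_of_support_subset (s := dyadicSquare (0, z))]
        · exact ((hgβ (0, z)).trans_lt ENNReal.coe_lt_top).ne
        · exact fun p hp => (hgsupp p hp).2
      refine (lintegral_le_of_kernel_bound hg hfin hJ hS (fun q hq => hq.2.1) ha hc
        (fun p hp => (hgsupp p hp).1.le) fun p hp => ?_).trans ?_
      · refine (lintegral_mono_set hJR).trans (hkernel g hg hgβ p fun q hq => ?_)
        have h1 := (hgsupp p hp).2
        have h2 := (hgsupp q hq).2
        rw [dyadicSquare_eq_prod, mem_prod, mem_Ico, mem_Ico] at h1 h2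
        simp only [pow_zero, div_one] at h1 h2
        rw [abs_le]
        constructor <;> linarith [h1.2.1, h1.2.2, h2.2.1, h2.2.2]
      · calc K * volume (E ∩ J ×ˢ univ) ≤ K * (K⁻¹ * (n : ℝ≥0∞)⁻¹) := by
              gcongr
              exact (measure_mono inter_subset_left).trans hEvol.le
          _ = (n : ℝ≥0∞)⁻¹ := by rw [← mul_assoc, ENNReal.mul_inv_cancel hK0 hKtop, one_mul]
    refine ⟨V, fun p hp => hV ⟨?_, hp.2⟩, hVsum⟩
    refine haJ.trans_le (measure_mono fun l hl => ?_)
    exact ⟨hBE (hCB p hp.1 l hl), hl, mem_univ _⟩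
  choose V hV hVsum using hcover
  have hs0 : (0 : ℝ) < s := by positivity
  have hdiam : ∀ Q, Metric.ediam (dyadicSquare Q) ^ (s : ℝ) ≤ (β ^ Q.1 : ℝ≥0) := by
    intro Q
    refine (ENNReal.rpow_le_rpow (ediam_dyadicSquare_le Q) hs0.le).trans_eq ?_
    rw [← ENNReal.coe_rpow_of_nonneg _ hs0.le, hβ, ← inv_pow, ← NNReal.rpow_natCast,
      ← NNReal.rpow_natCast, ← NNReal.rpow_mul, ← NNReal.rpow_mul, mul_comm]
  have hlim : Tendsto (fun n : ℕ => (n : ℝ≥0∞)⁻¹) atTop (𝓝 0) :=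
    ENNReal.tendsto_inv_nat_nhds_zero
  have hle := Measure.hausdorffMeasure_le_liminf_tsum (ι := fun n => V n) (s : ℝ)
    (C ∩ dyadicSquare (0, z)) (l := atTop) (fun n : ℕ => ((n : ℝ≥0∞)⁻¹) ^ (s⁻¹ : ℝ)) ?_
    (fun n Q => dyadicSquare Q) ?_ (Eventually.of_forall hV)
  · refine le_antisymm (hle.trans ?_) zero_le
    rw [← hlim.liminf_eq]
    refine liminf_le_liminf (Eventually.of_forall fun n => ?_)
    exact (ENNReal.tsum_le_tsum fun Q => hdiam _).trans (hVsum n)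
  · have := hlim.ennrpow_const (s⁻¹ : ℝ)
    rwa [ENNReal.zero_rpow_of_pos (inv_pos.2 hs0)] at this
  · refine Eventually.of_forall fun n Q => ?_
    rw [ENNReal.le_rpow_inv_iff hs0]
    exact (hdiam _).trans ((ENNReal.le_tsum Q).trans (hVsum n))

/-- **Marstrand's projection theorem**: if `C ⊆ ℝ²` is a Borel set with
Hausdorff dimension greater than `1`, then for Lebesgue-almost every `λ ∈ ℝ`
the projection `π_λ(C) = {x - λy : (x, y) ∈ C}` has positive one-dimensional
Lebesgue outer measure. -/
theorem marstrand_projection (C : Set (ℝ × ℝ)) (hC : MeasurableSet C)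
    (hdim : 1 < dimH C) :
    ∀ᵐ l : ℝ ∂(volume : Measure ℝ),
      0 < volume ((fun p : ℝ × ℝ => p.1 - l * p.2) '' C) := by
  by_contra hnot
  rw [ae_iff] at hnot
  set Γ : Set (ℝ × ℝ) := (fun z : ℝ × ℝ × ℝ => (z.1, z.2.1 - z.1 * z.2.2)) '' (univ ×ˢ C) with hΓ
  have hΓm : NullMeasurableSet Γ volume :=
    ((MeasurableSet.univ.prod hC).analyticSet.image_of_continuous
      (by fun_prop)).nullMeasurableSet _
  have hΓsec : ∀ l, {t | (l, t) ∈ Γ} = (fun p : ℝ × ℝ => p.1 - l * p.2) '' C := by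
    intro l
    ext t
    simp [hΓ]
  set B := toMeasurable volume Γ with hB
  have hBm : MeasurableSet B := measurableSet_toMeasurable _ _
  set N : Set ℝ := {l | volume {t | (l, t) ∈ B} = 0} with hN
  have hNm : MeasurableSet N := measurable_measure_prodMk_left hBm (measurableSet_singleton 0)
  have hN0 : volume N ≠ 0 := by
    refine fun h0 => hnot (measure_mono_null_ae ?_ h0)
    have hae : ∀ᵐ q ∂(volume.prod volume : Measure (ℝ × ℝ)), (q ∈ B) = (q ∈ Γ) :=
      hΓm.toMeasurable_ae_eq
    filter_upwards [Measure.ae_ae_of_ae_prod hae] with l hl hlC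
    have hlC' : ¬0 < volume ((fun p : ℝ × ℝ => p.1 - l * p.2) '' C) := hlC
    rw [← hΓsec, not_lt, nonpos_iff_eq_zero] at hlC'
    change volume {t | (l, t) ∈ B} = 0
    rw [← hlC']
    exact measure_congr hl
  obtain ⟨R, hR⟩ : ∃ R : ℕ, volume (N ∩ Icc (-R : ℝ) R) ≠ 0 := by
    by_contra! h
    refine hN0 (measure_mono_null (fun l hl => ?_) (measure_iUnion_null h))
    obtain ⟨R, hR⟩ := exists_nat_ge |l|
    exact mem_iUnion.2 ⟨R, hl, abs_le.1 hR⟩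
  set J := N ∩ Icc (-R : ℝ) R
  have hJ : MeasurableSet J := hNm.inter measurableSet_Icc
  have hBJ : volume (B ∩ J ×ˢ univ) = 0 := by
    rw [Measure.volume_eq_prod, Measure.measure_prod_null (hBm.inter (hJ.prod .univ))]
    refine Eventually.of_forall fun l => ?_
    by_cases hl : l ∈ J
    · exact measure_mono_null (fun t ht => ht.1) hl.1
    · refine measure_mono_null (fun t ht => hl ht.2.1) measure_empty
  obtain ⟨s, hs1, hs2⟩ := ENNReal.lt_iff_exists_nnreal_btwn.1
    (lt_min hdim (show (1 : ℝ≥0∞) < 2 by norm_num))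
  have htop := hausdorffMeasure_of_lt_dimH (hs2.trans_le (min_le_left _ _))
  have hzero : μH[s] C = 0 := by
    refine measure_mono_null (fun p hp => ?_) (measure_iUnion_null fun z : ℤ × ℤ =>
      hausdorffMeasure_inter_eq_zero (C := C) hJ hR inter_subset_right hBJ
        (fun p hp l hl => ⟨subset_toMeasurable _ _ ⟨(l, p), ⟨mem_univ _, hp⟩, rfl⟩, hl, mem_univ _⟩)
        (by exact_mod_cast hs1) (by exact_mod_cast hs2.trans_le (min_le_right _ _)) z)
    exact mem_iUnion.2 ⟨_, hp, mem_dyadicSquare_dyadicIndex 0 p⟩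
  simp [hzero] at htop
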